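/- Let k be a field, V a finite-dimensional k-vector space, x a nilpotent k-linear endomorphism of V, n ≥ 1, and l_1, …, l_n ≥ 0 integers with Σ_i i·l_i = dim V; set d_i := l_i + l_{i+1} + ⋯ + l_n. (a) For every chain of subspaces 0 = V_0 ⊆ V_1 ⊆ ⋯ ⊆ V_n = V with x(V_i) ⊆ V_{i−1} for all 1 ≤ i ≤ n, one has V_i ⊆ ker(x^i) for all i; in particular, if dim(V_i/V_{i−1}) = d_i for all i, then dim ker(x^i) ≥ d_1 + ⋯ + d_i for all i. (b) If moreover dim ker(x^i) = d_1 + ⋯ + d_i for all i, then there is exactly one chain 0 = V_0 ⊆ V_1 ⊆ ⋯ ⊆ V_n = V with x(V_i) ⊆ V_{i−1} and dim(V_i/V_{i−1}) = d_i for all i, namely V_i = ker(x^i). -/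

import Mathlib

section

variable (k V : Type) [Field k] [AddCommGroup V] [Module k V]

/-- A chain `0 = V₀ ⊆ V₁ ⊆ ⋯ ⊆ Vₙ = V` with `x(Vᵢ) ⊆ V_{i-1}` for `1 ≤ i ≤ n`. -/
def IsAdmissibleChain (x : V →ₗ[k] V) (n : ℕ) (Vc : ℕ → Submodule k V) : Prop :=
  Vc 0 = ⊥ ∧ Vc n = ⊤ ∧ (∀ i < n, Vc i ≤ Vc (i + 1)) ∧
    ∀ i, 1 ≤ i → i ≤ n → Submodule.map x (Vc i) ≤ Vc (i - 1)

/-- The condition `dim (Vᵢ/V_{i-1}) = d i` for all `1 ≤ i ≤ n`. -/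
def HasQuotientDims (n : ℕ) (d : ℕ → ℕ) (Vc : ℕ → Submodule k V) : Prop :=
  ∀ i, 1 ≤ i → i ≤ n →
    Module.finrank k (↥(Vc i) ⧸ Submodule.comap (Vc i).subtype (Vc (i - 1))) = d i

end

open Module in
/-- For `A ≤ B`, `dim (B / A) + dim A = dim B`. -/
theorem finrank_quotient_comap_subtype_add {k V : Type} [Field k] [AddCommGroup V] [Module k V]
    [FiniteDimensional k V] {A B : Submodule k V} (h : A ≤ B) :
    finrank k (↥B ⧸ Submodule.comap B.subtype A) + finrank k A = finrank k B := by
  rw [← (Submodule.comapSubtypeEquivOfLe h).finrank_eq]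
  exact Submodule.finrank_quotient_add_finrank _

/-- The tails `lᵢ + ⋯ + lₙ` sum to `Σ i·lᵢ`. -/
theorem sum_Icc_tail_sums (n : ℕ) (l : ℕ → ℕ) :
    ∑ i ∈ Finset.Icc 1 n, ∑ j ∈ Finset.Icc i n, l j = ∑ j ∈ Finset.Icc 1 n, j * l j := by
  rw [Finset.sum_comm' (t' := Finset.Icc 1 n) (s' := fun j => Finset.Icc 1 j)
    (fun i j => by simp only [Finset.mem_Icc]; lia)]
  simp

namespace IsAdmissibleChain

variable {k V : Type} [Field k] [AddCommGroup V] [Module k V] {x : V →ₗ[k] V} {n : ℕ}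
  {Vc : ℕ → Submodule k V}

theorem le_ker_pow (h : IsAdmissibleChain k V x n Vc) {i : ℕ} (hi : i ≤ n) :
    Vc i ≤ LinearMap.ker (x ^ i) := by
  obtain ⟨h0, -, -, hmap⟩ := h
  induction i with
  | zero => simp [h0]
  | succ i ih =>
    intro v hv
    have hxv : x v ∈ Vc i := hmap (i + 1) (by lia) hi (Submodule.mem_map_of_mem hv)
    simpa [pow_succ] using ih (by lia) hxv

theorem finrank_eq_sum [FiniteDimensional k V] (h : IsAdmissibleChain k V x n Vc) {d : ℕ → ℕ}
    (hd : HasQuotientDims k V n d Vc) {i : ℕ} (hi : i ≤ n) :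
    Module.finrank k (Vc i) = ∑ j ∈ Finset.Icc 1 i, d j := by
  obtain ⟨h0, -, hmono, -⟩ := h
  induction i with
  | zero => simp [h0]
  | succ i ih =>
    have hq := hd (i + 1) (by lia) hi
    rw [Nat.add_sub_cancel] at hq
    rw [← finrank_quotient_comap_subtype_add (hmono i hi), hq, ih (by lia),
      Finset.sum_Icc_succ_top (by lia), add_comm]

end IsAdmissibleChain

theorem ker_pow_le_ker_pow_succ {k V : Type} [Field k] [AddCommGroup V] [Module k V]
    (x : V →ₗ[k] V) (i : ℕ) : LinearMap.ker (x ^ i) ≤ LinearMap.ker (x ^ (i + 1)) := by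
  rw [pow_succ']
  exact LinearMap.ker_le_ker_comp _ _

/-- The kernels of the powers of `x` form an admissible chain as soon as `xⁿ = 0`. -/
theorem isAdmissibleChain_ker_pow {k V : Type} [Field k] [AddCommGroup V] [Module k V]
    {x : V →ₗ[k] V} {n : ℕ} (hn : LinearMap.ker (x ^ n) = ⊤) :
    IsAdmissibleChain k V x n (fun i => LinearMap.ker (x ^ i)) := by
  refine ⟨LinearMap.ker_id, hn, fun i _ => ker_pow_le_ker_pow_succ x i, fun i hi _ => ?_⟩
  obtain ⟨i, rfl⟩ := Nat.exists_eq_add_of_le' hi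
  rintro _ ⟨v, hv, rfl⟩
  simpa [pow_succ] using hv

theorem hasQuotientDims_ker_pow {k V : Type} [Field k] [AddCommGroup V] [Module k V]
    [FiniteDimensional k V] {x : V →ₗ[k] V} {n : ℕ} {d : ℕ → ℕ}
    (h : ∀ i ≤ n, Module.finrank k (LinearMap.ker (x ^ i)) = ∑ j ∈ Finset.Icc 1 i, d j) :
    HasQuotientDims k V n d (fun i => LinearMap.ker (x ^ i)) := by
  intro i hi hin
  obtain ⟨i, rfl⟩ := Nat.exists_eq_add_of_le' hi
  have hq := finrank_quotient_comap_subtype_add (ker_pow_le_ker_pow_succ x i)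
  rw [h i (by lia), h (i + 1) hin, Finset.sum_Icc_succ_top (by lia), add_comm] at hq
  exact Nat.add_left_cancel hq

/-- Unitriangularity for nilpotent endomorphisms. Let `x` be nilpotent on a
finite-dimensional space `V`, `n ≥ 1`, `Σ_{i=1}^n i·lᵢ = dim V` and
`dᵢ = lᵢ + l_{i+1} + ⋯ + lₙ`.
(a) Every chain `0 = V₀ ⊆ ⋯ ⊆ Vₙ = V` with `x(Vᵢ) ⊆ V_{i-1}` satisfies `Vᵢ ⊆ ker(xⁱ)`;
if moreover `dim (Vᵢ/V_{i-1}) = dᵢ` then `d₁ + ⋯ + dᵢ ≤ dim ker(xⁱ)`.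
(b) If `dim ker(xⁱ) = d₁ + ⋯ + dᵢ` for all `i ≤ n`, then the unique such chain with the
prescribed quotient dimensions is `Vᵢ = ker(xⁱ)`. -/
theorem admissible_chain_unitriangularity
    (k V : Type) [Field k] [AddCommGroup V] [Module k V] [FiniteDimensional k V]
    (x : V →ₗ[k] V) (hx : IsNilpotent x)
    (n : ℕ) (hn : 1 ≤ n) (l : ℕ → ℕ)
    (hsum : ∑ i ∈ Finset.Icc 1 n, i * l i = Module.finrank k V)
    (d : ℕ → ℕ) (hd : ∀ i, d i = ∑ j ∈ Finset.Icc i n, l j) :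
    (∀ Vc : ℕ → Submodule k V, IsAdmissibleChain k V x n Vc →
      (∀ i ≤ n, Vc i ≤ LinearMap.ker (x ^ i)) ∧
      (HasQuotientDims k V n d Vc →
        ∀ i ≤ n, (∑ j ∈ Finset.Icc 1 i, d j) ≤
          Module.finrank k (LinearMap.ker (x ^ i)))) ∧
    ((∀ i ≤ n, Module.finrank k (LinearMap.ker (x ^ i)) = ∑ j ∈ Finset.Icc 1 i, d j) →
      (IsAdmissibleChain k V x n (fun i => LinearMap.ker (x ^ i)) ∧
        HasQuotientDims k V n d (fun i => LinearMap.ker (x ^ i))) ∧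
      (∀ Vc : ℕ → Submodule k V, IsAdmissibleChain k V x n Vc →
        HasQuotientDims k V n d Vc → ∀ i ≤ n, Vc i = LinearMap.ker (x ^ i))) := by
  refine ⟨fun Vc hV => ⟨fun i hi => hV.le_ker_pow hi, fun hQ i hi => ?_⟩,
    fun hker => ⟨⟨isAdmissibleChain_ker_pow ?_, hasQuotientDims_ker_pow hker⟩,
      fun Vc hV hQ i hi => ?_⟩⟩
  · rw [← hV.finrank_eq_sum hQ hi]
    exact Submodule.finrank_mono (hV.le_ker_pow hi)
  · apply Submodule.eq_top_of_finrank_eq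
    rw [hker n le_rfl, ← hsum, ← sum_Icc_tail_sums]
    exact Finset.sum_congr rfl fun i _ => hd i
  · exact Submodule.eq_of_le_of_finrank_eq (hV.le_ker_pow hi)
      ((hV.finrank_eq_sum hQ hi).trans (hker i hi).symm)
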